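/- arXiv:2204.07158 — 5 statements merged into one kernel-verified Lean document; each statement's English description precedes it below -/
import Mathlib

section
/- Let P be a locally finite poset and let (x,y,z) be a triple of elements of P with x ≤ y ≤ z. Then ∑_{(a,b): x ≤ a ≤ y ≤ b ≤ z} μ(x,a)·μ(b,z) = δ₃(x,y,z), i.e. the sum equals 1 if x = y = z and equals 0 otherwise. (Equivalently, J ⋌ ζ₃ = δ₃, so the J-function J(x,y,z) = μ(x,y)·μ(y,z) is also a left inverse of the constant function ζ₃ under the convolution ⋌.) -/
open Finset IncidenceAlgebra

/-- `J ⋌ ζ₃ = δ₃`: the J-function `J(x,y,z) = μ(x,y)·μ(y,z)` is also a left inverse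
of the constant function `ζ₃` under the convolution `⋌`, i.e. for `x ≤ y ≤ z`,
`∑_{x ≤ a ≤ y ≤ b ≤ z} μ(x,a)·μ(b,z) = δ₃(x,y,z)`. -/
theorem J_conv_zeta3 {P : Type*} [PartialOrder P] [LocallyFiniteOrder P] [DecidableEq P]
    (x y z : P) (hxy : x ≤ y) (hyz : y ≤ z) :
    ∑ a ∈ Icc x y, ∑ b ∈ Icc y z, mu ℤ x a * mu ℤ b z =
      if x = y ∧ y = z then 1 else 0 := by
  rw [← Finset.sum_mul_sum, sum_Icc_mu_right, sum_Icc_mu_left]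
  by_cases h1 : x = y <;> by_cases h2 : y = z <;> simp [h1, h2]
end

section
/- Let P be a locally finite poset and R a commutative ring. Then δ₃ is a left identity for the convolution ⋌: for every f : Fl³(P) → R and every triple (x,y,z) with x ≤ y ≤ z, (δ₃ ⋌ f)(x,y,z) = f(x,y,z). -/
open Finset

/-- The convolution `(f ⋌ g)(x,y,z) = ∑_{x ≤ a ≤ y ≤ b ≤ z} f(x,a,a)·g(a,y,b)·f(b,b,z)`
on 3-variable incidence functions. -/
def conv3 {P R : Type*} [PartialOrder P] [LocallyFiniteOrder P] [CommRing R]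
    (f g : P → P → P → R) : P → P → P → R :=
  fun x y z => ∑ a ∈ Icc x y, ∑ b ∈ Icc y z, f x a a * g a y b * f b b z

/-- `δ₃(x,y,z) = 1` if `x = y = z` and `0` otherwise. -/
def delta3 {P R : Type*} [DecidableEq P] [CommRing R] : P → P → P → R :=
  fun x y z => if x = y ∧ y = z then 1 else 0

/-- `δ₃` is a left identity for the convolution `⋌`. -/
theorem delta3_conv {P R : Type*} [PartialOrder P] [LocallyFiniteOrder P] [DecidableEq P]
    [CommRing R] (f : P → P → P → R) (x y z : P) (hxy : x ≤ y) (hyz : y ≤ z) :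
    conv3 delta3 f x y z = f x y z := by
  unfold conv3 delta3
  rw [Finset.sum_eq_single x, Finset.sum_eq_single z]
  · simp
  · intro b _ hb
    simp [hb]
  · intro h
    exact absurd (Finset.mem_Icc.2 ⟨hyz, le_refl z⟩) h
  · intro a _ ha
    simp [Ne.symm ha]
  · intro h
    exact absurd (Finset.mem_Icc.2 ⟨le_refl x, hxy⟩) h
end

section
/- (Generalized Phillip Hall theorem.) Let P be a locally finite poset and (x,y,z) a triple of elements of P with x ≤ y ≤ z. Then μ(x,y)·μ(y,z) = ∑_{i,j ≥ 0} (−1)^{i+j} · c_{i,j}(x,y,z), where only finitely many terms of the sum are nonzero since the interval [x,z] is finite. -/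
open Finset IncidenceAlgebra

section aux
variable {P : Type*} [PartialOrder P] [LocallyFiniteOrder P] [DecidableEq P]

def hgN : ℕ → P → P → ℕ
  | 0, x, y => if x = y then 1 else 0
  | n + 1, x, y => ∑ a ∈ Ico x y, hgN n x a

lemma hgN_vanish (n : ℕ) (x y : P) (h : #(Ico x y) < n) : hgN n x y = 0 := by
  induction n generalizing y with
  | zero => omega
  | succ n ih =>
    rw [hgN]
    refine Finset.sum_eq_zero fun a ha => ih a ?_
    have : #(Ico x a) < #(Ico x y) := by
      refine Finset.card_lt_card ⟨?_, ?_⟩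
      · exact Finset.Ico_subset_Ico_right (Finset.mem_Ico.1 ha).2.le
      · intro hh
        have := hh ha
        simp at this
    omega

lemma hgN_mu (n : ℕ) (x y : P) (hxy : x ≤ y) (h : #(Ico x y) < n) :
    mu ℤ x y = ∑ k ∈ range n, (-1 : ℤ) ^ k * hgN k x y := by
  induction n generalizing y with
  | zero => omega
  | succ n ih =>
    rw [Finset.sum_range_succ']
    by_cases hxe : x = y
    · subst hxe
      simp [hgN]
    · rw [mu_eq_neg_sum_Ico_of_ne (hab := hxe)]
      simp only [hgN, hxe, if_false, Nat.cast_sum, Finset.mul_sum]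
      rw [Finset.sum_comm]
      simp only [Nat.cast_zero, mul_zero, add_zero]
      rw [← Finset.sum_neg_distrib]
      refine Finset.sum_congr rfl fun a ha => ?_
      rw [ih a (Finset.mem_Ico.1 ha).1, ← Finset.sum_neg_distrib]
      · refine Finset.sum_congr rfl fun k _ => ?_
        ring
      · have : #(Ico x a) < #(Ico x y) := by
          refine Finset.card_lt_card ⟨?_, ?_⟩
          · exact Finset.Ico_subset_Ico_right (Finset.mem_Ico.1 ha).2.le
          · intro hh
            have := hh ha
            simp at this
        omega

lemma hg_finite (n : ℕ) (Q : (Fin (n + 1) → P) → Prop) (x a : P) (hx : ∀ c, Q c → c 0 = x) :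
    Finite {c : Fin (n + 1) → P // StrictMono c ∧ Q c ∧ c (Fin.last n) = a} := by
  refine Finite.of_injective
    (β := Fin (n + 1) → Set.Icc x a)
    (fun c i => ⟨c.1 i, ?_, ?_⟩) ?_
  · rw [← hx _ c.2.2.1]; exact c.2.1.monotone (Fin.zero_le _)
  · exact (c.2.1.monotone (Fin.le_last _)).trans_eq c.2.2.2
  · intro c d h
    ext i
    exact congrArg Subtype.val (congrFun h i)

lemma hg_strictMono_snoc (n : ℕ) (c : Fin (n + 1) → P) (z : P) (hc : StrictMono c)
    (hz : c (Fin.last n) < z) : StrictMono (Fin.snoc c z : Fin (n + 2) → P) := by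
  rw [Fin.strictMono_iff_lt_succ]
  intro i
  induction i using Fin.lastCases with
  | last => simpa using hz
  | cast i =>
    rw [← Fin.castSucc_succ, Fin.snoc_castSucc, Fin.snoc_castSucc]
    exact hc (Fin.castSucc_lt_succ)

lemma hg_step (n : ℕ) (Q : (Fin (n + 1) → P) → Prop) (x y z : P) (hx : ∀ c, Q c → c 0 = x)
    (hy : ∀ c, StrictMono c → Q c → y ≤ c (Fin.last n)) :
    Nat.card {c : Fin (n + 2) → P //
      StrictMono c ∧ Q (fun i => c i.castSucc) ∧ c (Fin.last (n + 1)) = z} =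
    ∑ a ∈ Ico y z, Nat.card {c : Fin (n + 1) → P // StrictMono c ∧ Q c ∧ c (Fin.last n) = a} := by
  have hf := fun a : P => hg_finite n Q x a hx
  rw [← Finset.sum_coe_sort, ← Nat.card_sigma]
  refine Nat.card_congr ?_
  refine
    { toFun := fun c => ⟨⟨c.1 (Fin.last n).castSucc, ?_⟩,
        ⟨fun i => c.1 i.castSucc, ?_, c.2.2.1, rfl⟩⟩
      invFun := fun p => ⟨Fin.snoc p.2.1 z, ?_, ?_, ?_⟩
      left_inv := ?_
      right_inv := ?_ }
  · rw [Finset.mem_Ico]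
    refine ⟨hy (fun i => c.1 i.castSucc) (fun i j h => c.2.1 (by simpa using h)) c.2.2.1, ?_⟩
    conv_rhs => rw [← c.2.2.2]
    exact c.2.1 (Fin.castSucc_lt_last _)
  · exact fun i j h => c.2.1 (by simpa using h)
  · refine hg_strictMono_snoc n _ z p.2.2.1 ?_
    rw [p.2.2.2.2]
    exact (Finset.mem_Ico.1 p.1.2).2
  · simpa using p.2.2.2.1
  · simp
  · rintro ⟨c, h1, h2, h3⟩
    ext i
    induction i using Fin.lastCases with
    | last => simp [h3]
    | cast i => simp
  · rintro ⟨⟨a, ha⟩, ⟨c, h1, h2, h3⟩⟩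
    simp only at h3
    subst h3
    refine Sigma.subtype_ext ?_ ?_
    · simp
    · simp

lemma hg_card0 (i : ℕ) (x y : P) :
    Nat.card {c : Fin (i + 1) → P // StrictMono c ∧ c 0 = x ∧ c (Fin.last i) = y} =
      hgN i x y := by
  induction i generalizing y with
  | zero =>
    have hs : Subsingleton (Fin (0 + 1)) := inferInstanceAs (Subsingleton (Fin 1))
    rw [hgN]
    split_ifs with h
    · subst h
      rw [Nat.card_eq_one_iff_unique]
      refine ⟨⟨?_⟩, ⟨⟨fun _ => x, Subsingleton.strictMono _, rfl, rfl⟩⟩⟩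
      rintro ⟨c, h1, h2, h3⟩ ⟨d, h4, h5, h6⟩
      ext k
      rw [Subsingleton.elim k 0]
      simp only [h2, h5]
    · rw [Nat.card_eq_zero]
      left
      refine ⟨?_⟩
      rintro ⟨c, h1, h2, h3⟩
      exact h (h2.symm.trans h3)
  | succ i ih =>
    rw [hgN]
    simp only [← ih]
    exact hg_step i (fun c => c 0 = x) x x y (fun c h => h)
      (fun c hc h => by rw [← h]; exact hc.monotone (Fin.zero_le _))

lemma hg_card (i j : ℕ) (x y z : P) (hi : i < i + j + 1) :
    Nat.card {c : Fin (i + j + 1) → P //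
          StrictMono c ∧ c 0 = x ∧ c ⟨i, hi⟩ = y ∧ c (Fin.last (i + j)) = z} =
      hgN i x y * hgN j y z := by
  induction j generalizing z with
  | zero =>
    rw [hgN]
    split_ifs with h
    · subst h
      rw [mul_one, ← hg_card0]
      refine Nat.card_congr (Equiv.subtypeEquivRight fun c => ?_)
      exact ⟨fun h => ⟨h.1, h.2.1, h.2.2.1⟩, fun h => ⟨h.1, h.2.1, h.2.2, h.2.2⟩⟩
    · rw [mul_zero, Nat.card_eq_zero]
      left
      refine ⟨?_⟩
      rintro ⟨c, h1, h2, h3, h4⟩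
      exact h (h3.symm.trans h4)
  | succ j ih =>
    rw [hgN, Finset.mul_sum]
    have hi' : i < i + j + 1 := Nat.lt_succ_of_le (Nat.le_add_right i j)
    simp only [← ih _ hi']
    have := hg_step (i + j) (fun c => c 0 = x ∧ c ⟨i, hi'⟩ = y) x y z (fun c h => h.1)
      (fun c hc h => by rw [← h.2]; exact hc.monotone (Fin.le_last _))
    simp only [and_assoc] at this
    exact this

end aux

/-- Generalized Phillip Hall theorem: for `x ≤ y ≤ z` in a locally finite poset,
`J(x,y,z) = μ(x,y)·μ(y,z) = ∑_{i,j ≥ 0} (−1)^{i+j}·c_{i,j}(x,y,z)`, where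
`c_{i,j}(x,y,z)` is the number of strict chains `x = a₀ < a₁ < ⋯ < a_{i+j} = z`
with `a_i = y`. Only finitely many summands are nonzero, so the sum is a `finsum`. -/
theorem hall_gen {P : Type*} [PartialOrder P] [LocallyFiniteOrder P] [DecidableEq P]
    (x y z : P) (hxy : x ≤ y) (hyz : y ≤ z) :
    mu ℤ x y * mu ℤ y z =
      ∑ᶠ (i : ℕ) (j : ℕ), (-1 : ℤ) ^ (i + j) *
        (Nat.card {c : Fin (i + j + 1) → P //
          StrictMono c ∧ c 0 = x ∧ c ⟨i, by omega⟩ = y ∧ c (Fin.last (i + j)) = z} : ℤ) := by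
  simp only [hg_card]
  have hj : ∀ i : ℕ, ∑ᶠ (j : ℕ), (-1 : ℤ) ^ (i + j) * ((hgN i x y * hgN j y z : ℕ) : ℤ) =
      (-1) ^ i * hgN i x y * mu ℤ y z := by
    intro i
    rw [finsum_eq_sum_of_support_subset (s := range (#(Ico y z) + 1)),
      hgN_mu _ y z hyz (Nat.lt_succ_self _), Finset.mul_sum]
    · refine Finset.sum_congr rfl fun j _ => ?_
      push_cast
      ring
    · intro j hj
      by_contra hn
      refine hj ?_
      simp only [Finset.coe_range, Set.mem_Iio, not_lt] at hn
      simp [hgN_vanish j y z (by omega)]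
  simp only [hj]
  rw [finsum_eq_sum_of_support_subset (s := range (#(Ico x y) + 1)),
      hgN_mu _ x y hxy (Nat.lt_succ_self _), Finset.sum_mul]
  intro j hj
  by_contra hn
  refine hj ?_
  simp only [Finset.coe_range, Set.mem_Iio, not_lt] at hn
  simp [hgN_vanish j x y (by omega)]
end

section
/- (Generalized cross-cut theorem.) Let L be a finite lattice and x ≤ y ≤ z in L. Let S₁ be a lower cross-cut of the interval [x,y] and S₂ a lower cross-cut of the interval [y,z]. Then μ(x,y)·μ(y,z) = ∑ (−1)^{|A₁| + |A₂|}, the sum ranging over all pairs of subsets A₁ ⊆ S₁ and A₂ ⊆ S₂ such that the join of A₁ ∪ {x} equals y and the join of A₂ ∪ {y} equals z. -/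
open Finset IncidenceAlgebra

open Classical in
theorem crosscut_sum_Icc {L : Type*} [Lattice L] [DecidableEq L]
    [LocallyFiniteOrder L] (x y : L) (S : Finset L)
    (hsub : ∀ a ∈ S, a ∈ Set.Icc x y ∧ a ≠ x)
    (hcut : ∀ b ∈ Set.Icc x y, b ∉ S → b ≠ x → ∃ a ∈ S, a < b)
    (b : L) (hxb : x ≤ b) (hby : b ≤ y) :
    ∑ c ∈ Icc x b, ∑ A ∈ S.powerset,
        (if (insert x A).sup' (insert_nonempty x A) id = c then (-1 : ℤ) ^ A.card else 0)
      = if x = b then 1 else 0 := by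
  rw [Finset.sum_comm]
  have h1 : ∀ A ∈ S.powerset, (∑ c ∈ Icc x b,
      (if (insert x A).sup' (insert_nonempty x A) id = c then (-1 : ℤ) ^ A.card else 0))
      = if A ⊆ S.filter (· ≤ b) then (-1 : ℤ) ^ A.card else 0 := by
    intro A hA
    rw [Finset.sum_ite_eq]
    have hA' := Finset.mem_powerset.1 hA
    congr 1
    rw [Finset.mem_Icc, Finset.sup'_le_iff, eq_iff_iff]
    constructor
    · rintro ⟨-, h⟩ a ha
      exact Finset.mem_filter.2 ⟨hA' ha, h a (Finset.mem_insert_of_mem ha)⟩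
    · intro h
      refine ⟨Finset.le_sup' id (Finset.mem_insert_self x A), ?_⟩
      intro a ha
      rcases Finset.mem_insert.1 ha with rfl | ha
      · exact hxb
      · exact (Finset.mem_filter.1 (h ha)).2
  rw [Finset.sum_congr rfl h1, ← Finset.sum_filter]
  have h2 : S.powerset.filter (fun A => A ⊆ S.filter (· ≤ b))
      = (S.filter (· ≤ b)).powerset := by
    ext A
    simp only [Finset.mem_filter, Finset.mem_powerset]
    exact ⟨fun h => h.2, fun h => ⟨h.trans (Finset.filter_subset _ _), h⟩⟩
  rw [h2, Finset.sum_powerset_neg_one_pow_card]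
  congr 1
  rw [eq_iff_iff]
  constructor
  · intro h
    by_contra hne
    by_cases hb : b ∈ S
    · have : b ∈ S.filter (· ≤ b) := Finset.mem_filter.2 ⟨hb, le_rfl⟩
      simp [h] at this
    · obtain ⟨a, ha, hab⟩ := hcut b ⟨hxb, hby⟩ hb (Ne.symm hne)
      have : a ∈ S.filter (· ≤ b) := Finset.mem_filter.2 ⟨ha, hab.le⟩
      simp [h] at this
  · rintro rfl
    rw [Finset.filter_eq_empty_iff]
    intro a ha hax
    exact (hsub a ha).2 (le_antisymm hax (hsub a ha).1.1)

theorem crosscut_one {L : Type*} [Lattice L] [Fintype L] [DecidableEq L]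
    [LocallyFiniteOrder L] (x y : L) (S : Finset L)
    (hsub : ∀ a ∈ S, a ∈ Set.Icc x y ∧ a ≠ x)
    (hcut : ∀ b ∈ Set.Icc x y, b ∉ S → b ≠ x → ∃ a ∈ S, a < b)
    (b : L) : x ≤ b → b ≤ y →
    mu ℤ x b = ∑ A ∈ S.powerset,
        (if (insert x A).sup' (insert_nonempty x A) id = b then (-1 : ℤ) ^ A.card else 0) := by
  induction b using WellFoundedLT.induction with
  | ind b ih =>
    intro hxb hby
    have e1 := crosscut_sum_Icc x y S hsub hcut b hxb hby
    have e2 := sum_Icc_mu_right (𝕜 := ℤ) x b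
    rw [← Finset.Ico_insert_right hxb, Finset.sum_insert (by simp)] at e1 e2
    have e3 : ∑ c ∈ Ico x b, mu ℤ x c = ∑ c ∈ Ico x b, ∑ A ∈ S.powerset,
        (if (insert x A).sup' (insert_nonempty x A) id = c then (-1 : ℤ) ^ A.card else 0) := by
      refine Finset.sum_congr rfl fun c hc => ?_
      rw [Finset.mem_Ico] at hc
      exact ih c hc.2 hc.1 (hc.2.le.trans hby)
    rw [e3] at e2
    have e4 := e2.trans (Eq.trans (by congr) e1.symm)
    exact add_right_cancel (e4.trans (by congr))

/-- Generalized cross-cut theorem: if `x ≤ y ≤ z` in a finite lattice `L`, `S₁` is a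
lower cross-cut of `[x,y]` and `S₂` is a lower cross-cut of `[y,z]`, then
`μ(x,y)·μ(y,z) = ∑ (−1)^{|A₁|+|A₂|}`, the sum over pairs `A₁ ⊆ S₁`, `A₂ ⊆ S₂` such
that the join of `A₁ ∪ {x}` is `y` and the join of `A₂ ∪ {y}` is `z`. -/
theorem crosscut_gen {L : Type*} [Lattice L] [Fintype L] [DecidableEq L]
    [LocallyFiniteOrder L]
    (x y z : L) (hxy : x ≤ y) (hyz : y ≤ z)
    (S₁ S₂ : Finset L)
    (hS₁sub : ∀ a ∈ S₁, a ∈ Set.Icc x y ∧ a ≠ x)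
    (hS₁cut : ∀ b ∈ Set.Icc x y, b ∉ S₁ → b ≠ x → ∃ a ∈ S₁, a < b)
    (hS₂sub : ∀ a ∈ S₂, a ∈ Set.Icc y z ∧ a ≠ y)
    (hS₂cut : ∀ b ∈ Set.Icc y z, b ∉ S₂ → b ≠ y → ∃ a ∈ S₂, a < b) :
    mu ℤ x y * mu ℤ y z =
      ∑ A₁ ∈ S₁.powerset, ∑ A₂ ∈ S₂.powerset,
        if (insert x A₁).sup' (insert_nonempty x A₁) id = y ∧
            (insert y A₂).sup' (insert_nonempty y A₂) id = z then
          (-1 : ℤ) ^ (A₁.card + A₂.card)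
        else 0 := by
  rw [crosscut_one x y S₁ hS₁sub hS₁cut y hxy le_rfl,
    crosscut_one y z S₂ hS₂sub hS₂cut z hyz le_rfl, Finset.sum_mul_sum]
  refine Finset.sum_congr rfl fun A₁ _ => Finset.sum_congr rfl fun A₂ _ => ?_
  rw [ite_zero_mul_ite_zero, pow_add]
end

section
/- Let L be a finite graded semimodular lattice with rank function rk. Then every coefficient of the J-characteristic polynomial 𝒥(L,t) is nonnegative; that is, for every natural number k, (−1)^{rk(L)} · ∑_{x ∈ L, crk(x) = k} μ(⊥,x)·μ(x,⊤) ≥ 0. -/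
open Finset IncidenceAlgebra

theorem weisner_aux {L : Type*} [Lattice L] [Fintype L] [DecidableEq L]
    [LocallyFiniteOrder L] (a p : L) (hap : a < p) (c : L) (hpc : p ≤ c) :
    ∑ x ∈ (Icc a c).filter (fun x => x ⊔ p = c), mu ℤ a x = 0 := by
  induction c using WellFoundedLT.induction with
  | ind c ih =>
    have h0 : ∑ x ∈ Icc a c, mu ℤ a x = 0 := by
      rw [sum_Icc_mu_right, if_neg (hap.trans_le hpc).ne]
    have hm : ∀ x ∈ Icc a c, x ⊔ p ∈ Icc p c := by
      intro x hx
      rw [mem_Icc] at hx ⊢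
      exact ⟨le_sup_right, sup_le hx.2 hpc⟩
    rw [← sum_fiberwise_of_maps_to hm] at h0
    rw [sum_eq_single c] at h0
    · exact h0
    · intro d hd hdc
      rw [mem_Icc] at hd
      rw [← ih d (lt_of_le_of_ne hd.2 hdc) hd.1]
      apply sum_congr _ (fun _ _ => rfl)
      ext x
      simp only [mem_filter, mem_Icc]
      constructor
      · rintro ⟨⟨h1, _⟩, h3⟩
        exact ⟨⟨h1, h3 ▸ le_sup_left⟩, h3⟩
      · rintro ⟨⟨h1, h2⟩, h3⟩
        exact ⟨⟨h1, h2.trans hd.2⟩, h3⟩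
    · intro h
      exact absurd (mem_Icc.2 ⟨hpc, le_rfl⟩) h

theorem mu_sign_aux {L : Type*} [Lattice L] [Fintype L] [DecidableEq L]
    [LocallyFiniteOrder L] (rk : L → ℕ)
    (hrkcov : ∀ a b : L, a ⋖ b → rk b = rk a + 1)
    (hsemimod : ∀ a b : L, a ⊓ b ⋖ a → b ⋖ a ⊔ b) (a b : L) (hab : a ≤ b) :
    0 ≤ (-1 : ℤ) ^ (rk a + rk b) * mu ℤ a b := by
  induction b using WellFoundedLT.induction with
  | ind b ih =>
    rcases hab.eq_or_lt with rfl | hlt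
    · rw [mu_self, ← two_mul, pow_mul]; simp
    obtain ⟨p, hap, hpb⟩ := exists_covBy_le_of_lt hlt
    have hw := weisner_aux a p hap.lt b hpb
    rw [← add_sum_erase _ _ (a := b) (by simp [hab, hpb])] at hw
    rw [eq_neg_of_add_eq_zero_left hw, mul_neg, mul_sum, ← sum_neg_distrib]
    apply sum_nonneg
    intro x hx
    simp only [mem_erase, mem_filter, mem_Icc] at hx
    obtain ⟨hxb, ⟨hax, hxb'⟩, hxp⟩ := hx
    have hnp : ¬ p ≤ x := fun h => hxb (by rw [← hxp, sup_eq_left.2 h])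
    have hinf : p ⊓ x = a := by
      rcases hap.eq_or_eq (le_inf hap.le hax) inf_le_left with h | h
      · exact h
      · exact absurd (inf_eq_left.1 h) hnp
    have hc := hsemimod p x (hinf ▸ hap)
    rw [sup_comm, hxp] at hc
    have := ih x hc.lt hax
    rw [hrkcov x b hc, ← add_assoc, pow_succ]
    linarith

/-- For a finite graded semimodular lattice `L`, every coefficient of the
J-characteristic polynomial `𝒥(L,t)` is nonnegative: for every `k`,
`0 ≤ (−1)^{rk(L)} · ∑_{crk(x) = k} μ(⊥,x)·μ(x,⊤)`. -/
theorem J_char_coeff_nonneg {L : Type*} [Lattice L] [Fintype L] [DecidableEq L]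
    [BoundedOrder L] [LocallyFiniteOrder L]
    (rk : L → ℕ) (hrk0 : rk ⊥ = 0)
    (hrkcov : ∀ a b : L, a ⋖ b → rk b = rk a + 1)
    (hsemimod : ∀ a b : L, a ⊓ b ⋖ a → b ⋖ a ⊔ b)
    (k : ℕ) :
    0 ≤ (-1 : ℤ) ^ (rk ⊤) *
      ∑ x ∈ univ.filter (fun x => rk ⊤ - rk x = k), mu ℤ ⊥ x * mu ℤ x ⊤ := by
  rw [mul_sum]
  apply sum_nonneg
  intro x _
  have h1 := mu_sign_aux rk hrkcov hsemimod ⊥ x bot_le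
  have h2 := mu_sign_aux rk hrkcov hsemimod x ⊤ le_top
  have h3 := mul_nonneg h1 h2
  have h4 : (-1 : ℤ) ^ (rk x) * (-1) ^ (rk x) = 1 := by
    rw [← mul_pow]; simp
  rw [hrk0, zero_add, pow_add] at h3
  calc (0 : ℤ) ≤ _ := h3
    _ = ((-1 : ℤ) ^ (rk x) * (-1) ^ (rk x)) * ((-1) ^ (rk ⊤) * (mu ℤ ⊥ x * mu ℤ x ⊤)) := by ring
    _ = _ := by rw [h4, one_mul]
end
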